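/- For every rotor sequence NEXT, every even initial configuration of the Propp machine, and every time T ∈ ℕ₀, the discrepancy at the origin between the Propp machine and the linear machine equals the sum of the contributions of all vertices: f(0,T) − E(0,T) = ∑_{x ∈ V} CON(x), where only finitely many summands are nonzero (namely those with ‖x‖_∞ ≤ T). -/

import Mathlib

open Finset

/-- Vertices: we work on `ℤ × ℤ`; the grid `V` consists of points with
`x₁ ≡ x₂ (mod 2)`. -/
abbrev Vtx : Type := ℤ × ℤ

/-- The four diagonal directions. -/
def DIRset : Finset Vtx := {(1,1), (1,-1), (-1,-1), (-1,1)}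

/-- Membership in `V`: both coordinates have the same parity. -/
def inV (x : Vtx) : Prop := x.1 % 2 = x.2 % 2

/-- `H x t`: probability that a random-walk chip starting at `x` is at the
origin after `t` steps. -/
noncomputable def H (x : Vtx) (t : ℕ) : ℝ :=
  if x.1 % 2 = (t : ℤ) % 2 ∧ x.2 % 2 = (t : ℤ) % 2 ∧ |x.1| ≤ (t : ℤ) ∧ |x.2| ≤ (t : ℤ) then
    (4 : ℝ) ^ (-(t : ℤ)) * (Nat.choose t (((t : ℤ) + x.1) / 2).toNat)
      * (Nat.choose t (((t : ℤ) + x.2) / 2).toNat)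
  else 0

/-- `INF x A t := H (x+A) (t-1) - H x t`, for `t ≥ 1`. -/
noncomputable def INF (x A : Vtx) (t : ℕ) : ℝ := H (x + A) (t - 1) - H x t

/-- A rotor sequence: a cyclic permutation of the four directions. -/
def IsRotorSequence (next : Vtx → Vtx) : Prop :=
  ∀ A ∈ DIRset, ({A, next A, next^[2] A, next^[3] A} : Finset Vtx) = DIRset

/-- One step of the Propp machine: a vertex holding `k` chips and rotor `d`
sends chip `i` (for `i = 0, …, k-1`) to `x + next^[i] d` and sets its rotor
to `next^[k] d`. -/
def proppStep (next : Vtx → Vtx) (st : (Vtx → ℕ) × (Vtx → Vtx)) :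
    (Vtx → ℕ) × (Vtx → Vtx) :=
  (fun y => ∑ A ∈ DIRset,
      ((Finset.range (st.1 (y - A))).filter (fun i => next^[i] (st.2 (y - A)) = A)).card,
   fun x => next^[st.1 x] (st.2 x))

/-- The Propp machine after `t` steps: chip counts and rotor directions. -/
def propp (next : Vtx → Vtx) (f0 : Vtx → ℕ) (arr0 : Vtx → Vtx) :
    ℕ → (Vtx → ℕ) × (Vtx → Vtx)
  | 0 => (f0, arr0)
  | t + 1 => proppStep next (propp next f0 arr0 t)

/-- An initial configuration is even if chips lie only on vertices `x ~ 0`. -/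
def EvenConfig (f0 : Vtx → ℕ) : Prop :=
  ∀ x : Vtx, ¬(x.1 % 2 = 0 ∧ x.2 % 2 = 0) → f0 x = 0

/-- The linear machine: each vertex sends a quarter of its chips to each
neighbor. -/
noncomputable def lin (f0 : Vtx → ℕ) : ℕ → Vtx → ℝ
  | 0 => fun x => (f0 x : ℝ)
  | t + 1 => fun x => (1/4) * ∑ A ∈ DIRset, lin f0 t (x + A)

/-- `sTime … x i`: the first time `u` with `i < ∑_{t=0}^{u} f(x,t)`, i.e. the
time at which `x` is occupied by its `i`-th chip. -/
noncomputable def sTime (next : Vtx → Vtx) (f0 : Vtx → ℕ) (arr0 : Vtx → Vtx)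
    (x : Vtx) (i : ℕ) : ℕ :=
  sInf {u : ℕ | i < ∑ t ∈ Finset.range (u + 1), (propp next f0 arr0 t).1 x}

/-- The contribution of vertex `x` for run-time `T`.  The chips with
`s_i(x) < T` are exactly those with `i < ∑_{t=0}^{T-1} f(x,t)`. -/
noncomputable def con (next : Vtx → Vtx) (f0 : Vtx → ℕ) (arr0 : Vtx → Vtx)
    (x : Vtx) (T : ℕ) : ℝ :=
  ∑ i ∈ Finset.range (∑ t ∈ Finset.range T, (propp next f0 arr0 t).1 x),
    INF x (next^[i] (arr0 x)) (T - sTime next f0 arr0 x i)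

/-- `maxcon next x`: supremum of `con` over all even initial configurations
(with rotors pointing in directions of `DIRset`) and all run-times. -/
noncomputable def maxcon (next : Vtx → Vtx) (x : Vtx) : ℝ :=
  sSup {c : ℝ | ∃ f0 arr0 T, EvenConfig f0 ∧ (∀ y : Vtx, arr0 y ∈ DIRset) ∧
    c = con next f0 arr0 x T}

/-- `mincon next x`: infimum of `con` over all even initial configurations
(with rotors pointing in directions of `DIRset`) and all run-times. -/
noncomputable def mincon (next : Vtx → Vtx) (x : Vtx) : ℝ :=
  sInf {c : ℝ | ∃ f0 arr0 T, EvenConfig f0 ∧ (∀ y : Vtx, arr0 y ∈ DIRset) ∧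
    c = con next f0 arr0 x T}

noncomputable def hh (a : ℤ) (t : ℕ) : ℝ :=
  if a % 2 = (t : ℤ) % 2 ∧ |a| ≤ (t : ℤ) then
    ((2 : ℝ) ^ t)⁻¹ * (Nat.choose t (((t : ℤ) + a) / 2).toNat) else 0

lemma H_eq (x : Vtx) (t : ℕ) : H x t = hh x.1 t * hh x.2 t := by
  unfold H hh
  by_cases h1 : x.1 % 2 = (t : ℤ) % 2 ∧ |x.1| ≤ (t : ℤ)
  · by_cases h2 : x.2 % 2 = (t : ℤ) % 2 ∧ |x.2| ≤ (t : ℤ)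
    · rw [if_pos ⟨h1.1, h2.1, h1.2, h2.2⟩, if_pos h1, if_pos h2, zpow_neg, zpow_natCast]
      have : (4 : ℝ) ^ t = 2 ^ t * 2 ^ t := by rw [← mul_pow]; norm_num
      rw [this, mul_inv]
      ring
    · rw [if_neg h2, if_neg (fun h => h2 ⟨h.2.1, h.2.2.2⟩), mul_zero]
  · rw [if_neg h1, if_neg (fun h => h1 ⟨h.1, h.2.2.1⟩), zero_mul]

lemma hh_val (k t : ℕ) : hh (2 * (k : ℤ) - t) t = ((2 : ℝ) ^ t)⁻¹ * Nat.choose t k := by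
  unfold hh
  by_cases hk : k ≤ t
  · rw [if_pos ⟨by omega, by rw [abs_le]; omega⟩]
    congr 3
    omega
  · rw [if_neg (by rw [abs_le]; omega), Nat.choose_eq_zero_of_lt (by omega)]
    simp

lemma hh_zero (a : ℤ) (t : ℕ) (h : (t : ℤ) < |a|) : hh a t = 0 := by
  unfold hh
  rw [if_neg]
  omega

lemma hh_par (a : ℤ) (t : ℕ) (h : a % 2 ≠ (t : ℤ) % 2) : hh a t = 0 := by
  unfold hh
  rw [if_neg]
  tauto

lemma hh_succ (a : ℤ) (t : ℕ) : hh a (t + 1) = (1 / 2) * (hh (a + 1) t + hh (a - 1) t) := by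
  by_cases hp : a % 2 = ((t + 1 : ℕ) : ℤ) % 2
  · by_cases hb : |a| ≤ ((t + 1 : ℕ) : ℤ)
    · rw [abs_le] at hb
      obtain ⟨k, hk⟩ : ∃ k : ℕ, a = 2 * (k : ℤ) - ((t + 1 : ℕ) : ℤ) :=
        ⟨(((t + 1 : ℕ) + a) / 2).toNat, by omega⟩
      have e1 : a + 1 = 2 * (k : ℤ) - t := by omega
      rw [e1, hk, hh_val, hh_val]
      rcases k with _ | k
      · rw [hh_zero _ t (by rw [lt_abs]; push_cast; omega)]
        simp [pow_succ]
      · have e2 : 2 * ((k + 1 : ℕ) : ℤ) - ((t + 1 : ℕ) : ℤ) - 1 = 2 * (k : ℤ) - t := by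
          push_cast; ring
        rw [e2, hh_val, Nat.choose_succ_succ, pow_succ, mul_inv]
        push_cast
        ring
    · rw [not_le, lt_abs] at hb
      rw [hh_zero a _ (by rw [lt_abs]; omega), hh_zero (a + 1) _ (by rw [lt_abs]; omega),
        hh_zero (a - 1) _ (by rw [lt_abs]; omega)]
      ring
  · rw [hh_par a _ hp, hh_par (a + 1) _ (by omega), hh_par (a - 1) _ (by omega)]
    ring

lemma sum_DIR {M : Type*} [AddCommMonoid M] (g : Vtx → M) :
    ∑ A ∈ DIRset, g A = g (1, 1) + (g (1, -1) + (g (-1, -1) + g (-1, 1))) := by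
  unfold DIRset
  rw [Finset.sum_insert (by decide), Finset.sum_insert (by decide),
    Finset.sum_insert (by decide), Finset.sum_singleton]

lemma H_succ (x : Vtx) (t : ℕ) : H x (t + 1) = (1 / 4) * ∑ A ∈ DIRset, H (x - A) t := by
  rw [sum_DIR]
  simp only [H_eq, hh_succ, Prod.fst_sub, Prod.snd_sub, sub_neg_eq_add]
  ring

lemma H_zero (x : Vtx) (t : ℕ) (h : (t : ℤ) < max |x.1| |x.2|) : H x t = 0 := by
  rw [H_eq]
  rcases lt_max_iff.1 h with h | h
  · rw [hh_zero _ _ h, zero_mul]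
  · rw [hh_zero _ _ h, mul_zero]

lemma DIR_abs {A : Vtx} (h : A ∈ DIRset) : |A.1| = 1 ∧ |A.2| = 1 := by
  revert A
  decide

lemma H_add_zero (x A : Vtx) (hA : A ∈ DIRset) (t : ℕ) (h : (t : ℤ) + 1 < max |x.1| |x.2|) :
    H (x + A) t = 0 := by
  obtain ⟨h1, h2⟩ := DIR_abs hA
  apply H_zero
  have e1 := abs_sub_abs_le_abs_sub x.1 (-A.1)
  have e2 := abs_sub_abs_le_abs_sub x.2 (-A.2)
  rw [abs_neg, sub_neg_eq_add] at e1 e2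
  rw [lt_max_iff] at h ⊢
  simp only [Prod.fst_add, Prod.snd_add]
  omega

noncomputable def BB (T : ℕ) : Finset Vtx :=
  Finset.Icc (-(T : ℤ)) (T : ℤ) ×ˢ Finset.Icc (-(T : ℤ)) (T : ℤ)

lemma not_mem_BB {T : ℕ} {x : Vtx} (h : x ∉ BB T) : (T : ℤ) < max |x.1| |x.2| := by
  unfold BB at h
  rw [Finset.mem_product, Finset.mem_Icc, Finset.mem_Icc, ← abs_le, ← abs_le] at h
  rw [lt_max_iff]
  omega

lemma sum_shift (T : ℕ) (A : Vtx) (g : Vtx → ℝ) (h1 : ∀ x, x ∉ BB T → g x = 0)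
    (h2 : ∀ x, x ∉ BB T → g (x + A) = 0) :
    ∑ x ∈ BB T, g x = ∑ x ∈ BB T, g (x + A) := by
  rw [← finsum_eq_sum_of_support_subset g, ← finsum_eq_sum_of_support_subset (fun x => g (x + A))]
  · exact (finsum_comp_equiv (Equiv.addRight A) (f := g)).symm
  · intro x hx
    by_contra hc
    exact hx (h2 x hc)
  · intro x hx
    by_contra hc
    exact hx (h1 x hc)

/-- Shift lemma specialised to weights `H`. -/
lemma sum_shift_H (T t : ℕ) (ht : t + 1 ≤ T) (A : Vtx) (hA : A ∈ DIRset) (c : Vtx → ℝ) :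
    ∑ y ∈ BB T, c (y - A) * H y t = ∑ x ∈ BB T, c x * H (x + A) t := by
  rw [sum_shift T A (fun y => c (y - A) * H y t)]
  · simp
  · intro x hx
    have := not_mem_BB hx
    rw [H_zero x t (by omega), mul_zero]
  · intro x hx
    have := not_mem_BB hx
    rw [H_add_zero x A hA t (by omega), mul_zero]

lemma DIR_neg {A : Vtx} (h : A ∈ DIRset) : -A ∈ DIRset := by
  revert A
  decide

lemma lin_inv (f0 : Vtx → ℕ) (T t s : ℕ) (h : t + s + 1 = T) :
    ∑ x ∈ BB T, lin f0 (t + 1) x * H x s = ∑ x ∈ BB T, lin f0 t x * H x (s + 1) := by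
  have e1 : ∀ x, lin f0 (t + 1) x * H x s
      = ∑ A ∈ DIRset, (1 / 4) * (lin f0 t (x - -A) * H x s) := by
    intro x
    simp only [lin, sub_neg_eq_add]
    rw [Finset.mul_sum, Finset.sum_mul]
    apply Finset.sum_congr rfl
    intros; ring
  simp_rw [e1]
  rw [Finset.sum_comm]
  have e2 : ∀ x, lin f0 t x * H x (s + 1)
      = ∑ A ∈ DIRset, (1 / 4) * (lin f0 t x * H (x + -A) s) := by
    intro x
    rw [H_succ, Finset.mul_sum, Finset.mul_sum]
    apply Finset.sum_congr rfl
    intros; rw [← sub_eq_add_neg]; ring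
  simp_rw [e2]
  rw [Finset.sum_comm (s := BB T)]
  apply Finset.sum_congr rfl
  intro A hA
  rw [← Finset.mul_sum, ← Finset.mul_sum, sum_shift_H T s (by omega) (-A) (DIR_neg hA)]

lemma sum_H_zero (T : ℕ) (c : Vtx → ℝ) : ∑ x ∈ BB T, c x * H x 0 = c (0, 0) := by
  rw [Finset.sum_eq_single (0, 0)]
  · simp [H]
  · intro x _ hx
    rw [H_zero, mul_zero]
    rw [lt_max_iff]
    by_contra hc
    push Not at hc
    simp at hc
    exact hx (Prod.ext hc.1 hc.2)
  · intro h
    exfalso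
    apply h
    simp [BB]

lemma lin_eq (f0 : Vtx → ℕ) (T : ℕ) :
    lin f0 T (0, 0) = ∑ x ∈ BB T, (f0 x : ℝ) * H x T := by
  have key : ∀ t s, t + s = T → ∑ x ∈ BB T, lin f0 t x * H x s = ∑ x ∈ BB T, (f0 x : ℝ) * H x T := by
    intro t
    induction t with
    | zero => intro s hs; obtain rfl : s = T := by omega
              rfl
    | succ t ih => intro s hs; rw [lin_inv f0 T t s (by omega), ih (s + 1) (by omega)]
  rw [← key T 0 rfl, sum_H_zero]

lemma next_mem {next : Vtx → Vtx} (hn : IsRotorSequence next) {A : Vtx} (hA : A ∈ DIRset) :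
    next A ∈ DIRset := by
  rw [← hn A hA]
  simp

lemma iter_mem {next : Vtx → Vtx} (hn : IsRotorSequence next) {A : Vtx} (hA : A ∈ DIRset) (i : ℕ) :
    next^[i] A ∈ DIRset := by
  induction i with
  | zero => exact hA
  | succ i ih => rw [Function.iterate_succ_apply']; exact next_mem hn ih

lemma arr_eq (next : Vtx → Vtx) (f0 : Vtx → ℕ) (arr0 : Vtx → Vtx) (x : Vtx) (t : ℕ) :
    (propp next f0 arr0 t).2 x
      = next^[∑ s ∈ Finset.range t, (propp next f0 arr0 s).1 x] (arr0 x) := by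
  induction t with
  | zero => rfl
  | succ t ih =>
    rw [Finset.sum_range_succ, add_comm (∑ s ∈ Finset.range t, _), Function.iterate_add_apply, ← ih]
    rfl

lemma propp_step_sum (next : Vtx → Vtx) (hn : IsRotorSequence next) (f0 : Vtx → ℕ)
    (arr0 : Vtx → Vtx) (harr : ∀ y : Vtx, arr0 y ∈ DIRset) (T t s : ℕ) (h : t + s + 1 = T) :
    ∑ x ∈ BB T, ((propp next f0 arr0 (t + 1)).1 x : ℝ) * H x s
      = ∑ x ∈ BB T, ∑ i ∈ Finset.range ((propp next f0 arr0 t).1 x),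
          H (x + next^[i] ((propp next f0 arr0 t).2 x)) s := by
  set st := propp next f0 arr0 t with hst
  have e1 : ∀ x, ((propp next f0 arr0 (t + 1)).1 x : ℝ) * H x s = ∑ A ∈ DIRset,
      (fun z => (((Finset.range (st.1 z)).filter (fun i => next^[i] (st.2 z) = A)).card : ℝ)) (x - A)
        * H x s := by
    intro x
    rw [← Finset.sum_mul]
    simp only [propp, proppStep]
    push_cast
    rfl
  rw [Finset.sum_congr rfl (fun x _ => e1 x), Finset.sum_comm]
  rw [Finset.sum_congr rfl (fun A hA => sum_shift_H T s (by omega) A hA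
    (fun z => (((Finset.range (st.1 z)).filter (fun i => next^[i] (st.2 z) = A)).card : ℝ))),
    Finset.sum_comm]
  apply Finset.sum_congr rfl
  intro x _
  rw [← Finset.sum_fiberwise_of_maps_to (s := Finset.range (st.1 x)) (t := DIRset)
    (g := fun i => next^[i] (st.2 x))]
  · apply Finset.sum_congr rfl
    intro A _
    rw [Finset.sum_congr rfl (g := fun _ => H (x + A) s)]
    · simp
    · intro i hi
      rw [(Finset.mem_filter.1 hi).2]
  · intro i _
    apply iter_mem hn
    rw [hst, arr_eq]
    exact iter_mem hn (harr x) _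

lemma sTime_eq (next : Vtx → Vtx) (f0 : Vtx → ℕ) (arr0 : Vtx → Vtx) (x : Vtx) (n i : ℕ)
    (hi : i < (propp next f0 arr0 n).1 x) :
    sTime next f0 arr0 x ((∑ t ∈ Finset.range n, (propp next f0 arr0 t).1 x) + i) = n := by
  unfold sTime
  apply le_antisymm
  · apply Nat.sInf_le
    simp only [Set.mem_ofPred_eq]
    rw [Finset.sum_range_succ]
    omega
  · apply le_csInf
    · refine ⟨n, ?_⟩
      simp only [Set.mem_ofPred_eq]
      rw [Finset.sum_range_succ]
      omega
    · intro u hu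
      simp only [Set.mem_ofPred_eq] at hu
      by_contra hc
      have := Finset.sum_le_sum_of_subset (f := fun t => (propp next f0 arr0 t).1 x)
        (Finset.range_mono (show u + 1 ≤ n by omega))
      omega

lemma con_aux (next : Vtx → Vtx) (f0 : Vtx → ℕ) (arr0 : Vtx → Vtx) (x : Vtx) (T n : ℕ) :
    ∑ i ∈ Finset.range (∑ t ∈ Finset.range n, (propp next f0 arr0 t).1 x),
      INF x (next^[i] (arr0 x)) (T - sTime next f0 arr0 x i)
    = ∑ t ∈ Finset.range n, ∑ i ∈ Finset.range ((propp next f0 arr0 t).1 x),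
        INF x (next^[i] ((propp next f0 arr0 t).2 x)) (T - t) := by
  induction n with
  | zero => simp
  | succ n ih =>
    rw [Finset.sum_range_succ, Finset.sum_range_add, ih, Finset.sum_range_succ]
    congr 1
    apply Finset.sum_congr rfl
    intro i hi
    rw [sTime_eq _ _ _ _ _ _ (Finset.mem_range.1 hi), arr_eq, ← Function.iterate_add_apply, add_comm i]

lemma propp_eq (next : Vtx → Vtx) (hn : IsRotorSequence next) (f0 : Vtx → ℕ)
    (arr0 : Vtx → Vtx) (harr : ∀ y : Vtx, arr0 y ∈ DIRset) (T n : ℕ) (hnT : n ≤ T) :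
    ∑ x ∈ BB T, ((propp next f0 arr0 n).1 x : ℝ) * H x (T - n)
      - ∑ x ∈ BB T, (f0 x : ℝ) * H x T
    = ∑ x ∈ BB T, ∑ t ∈ Finset.range n, ∑ i ∈ Finset.range ((propp next f0 arr0 t).1 x),
        INF x (next^[i] ((propp next f0 arr0 t).2 x)) (T - t) := by
  induction n with
  | zero => simp [propp]
  | succ n ih =>
    have ih := ih (by omega)
    simp_rw [Finset.sum_range_succ]
    rw [Finset.sum_add_distrib, ← ih, propp_step_sum next hn f0 arr0 harr T n (T - (n + 1)) (by omega)]
    simp only [INF, Finset.sum_sub_distrib, Finset.sum_const, Finset.card_range, nsmul_eq_mul,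
      Nat.sub_sub]
    ring

/-- The discrepancy at the origin between Propp machine and linear machine
equals the sum of the contributions of all vertices; only vertices with
`‖x‖_∞ ≤ T` contribute (all other contributions vanish). -/
theorem discrepancy_eq_sum_contributions (next : Vtx → Vtx)
    (hnext : IsRotorSequence next) (f0 : Vtx → ℕ) (arr0 : Vtx → Vtx)
    (hf0 : EvenConfig f0) (harr : ∀ y : Vtx, arr0 y ∈ DIRset) (T : ℕ) :
    (((propp next f0 arr0 T).1 (0, 0) : ℝ) - lin f0 T (0, 0)
      = ∑ x ∈ Finset.Icc (-(T : ℤ)) (T : ℤ) ×ˢ Finset.Icc (-(T : ℤ)) (T : ℤ),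
          con next f0 arr0 x T)
    ∧ ∀ x : Vtx, (T : ℤ) < max |x.1| |x.2| → con next f0 arr0 x T = 0 := by
  refine ⟨?_, ?_⟩
  · change _ = ∑ x ∈ BB T, con next f0 arr0 x T
    have h := propp_eq next hnext f0 arr0 harr T T le_rfl
    rw [Nat.sub_self, sum_H_zero T (fun x => ((propp next f0 arr0 T).1 x : ℝ)), ← lin_eq] at h
    rw [h]
    apply Finset.sum_congr rfl
    intro x _
    rw [con, con_aux]
  · intro x hx
    rw [con, con_aux]
    apply Finset.sum_eq_zero
    intro t ht
    apply Finset.sum_eq_zero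
    intro i _
    have ht := Finset.mem_range.1 ht
    rw [INF, H_zero x _ (by omega), H_add_zero x _ _ _ (by omega), sub_zero]
    apply iter_mem hnext
    rw [arr_eq]
    exact iter_mem hnext (harr x) _
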